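/- Let N = M and c ∈ Sym⁰_N. Suppose that for k = 1,…,K we have distinct pairs of marginals (μ^(k),ν^(k)) ∈ Δ_N × Δ_N, plans π^(k) ∈ OPT_c(μ^(k),ν^(k)) with α^(k) = ⟨c,π^(k)⟩, and extreme points u^(1,k),…,u^(L_k,k) ∈ EP(μ^(k),ν^(k)) representing π^(k). (a) If the family {T(u^(ℓ,k)) : ℓ ∈ {1,…,L_k}, k ∈ {1,…,K}} contains N(N−1)/2 linearly independent vectors, then c is identifiable in Sym⁰_N: any c' ∈ Sym⁰_N with ⟨c',π^(k)⟩ = OT_{c'}(μ^(k),ν^(k)) = α^(k) for all k equals c. (b) Conversely, if the convex hull of {u^(ℓ,k) : ℓ} equals OPT_c(μ^(k),ν^(k)) for every k and the family {T(u^(ℓ,k))} spans a space of dimension less than N(N−1)/2, then there exists c' ∈ Sym⁰_N with c' ≠ c and ⟨c',π^(k)⟩ = OT_{c'}(μ^(k),ν^(k)) = α^(k) for all k. -/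

import Mathlib

open Finset

noncomputable section

/-- Frobenius inner product of two `N × N` real matrices. -/
def frob {N : ℕ} (c π : Matrix (Fin N) (Fin N) ℝ) : ℝ := ∑ i, ∑ j, c i j * π i j

/-- The set `Π(μ,ν)` of transport plans between `μ` and `ν`. -/
def Plans {N : ℕ} (μ ν : Fin N → ℝ) : Set (Matrix (Fin N) (Fin N) ℝ) :=
  {π | (∀ i j, 0 ≤ π i j) ∧ (∀ i, ∑ j, π i j = μ i) ∧ (∀ j, ∑ i, π i j = ν j)}

/-- The optimal transport cost `OT_c(μ,ν)`. -/
def OTcost {N : ℕ} (c : Matrix (Fin N) (Fin N) ℝ) (μ ν : Fin N → ℝ) : ℝ :=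
  sInf (frob c '' Plans μ ν)

/-- The set `OPT_c(μ,ν)` of optimal transport plans. -/
def OPT {N : ℕ} (c : Matrix (Fin N) (Fin N) ℝ) (μ ν : Fin N → ℝ) :
    Set (Matrix (Fin N) (Fin N) ℝ) :=
  {π ∈ Plans μ ν | frob c π = OTcost c μ ν}

/-- The set `EP(μ,ν)` of extreme points of the transport polytope. -/
def EP {N : ℕ} (μ ν : Fin N → ℝ) : Set (Matrix (Fin N) (Fin N) ℝ) :=
  Set.extremePoints ℝ (Plans μ ν)

/-- Symmetric matrices with zero diagonal. -/
def Sym0 (N : ℕ) : Set (Matrix (Fin N) (Fin N) ℝ) :=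
  {c | (∀ i, c i i = 0) ∧ ∀ i j, c i j = c j i}

/-- The symmetrized upper-triangular part: `T(π) = (π_{i,j} + π_{j,i})_{i<j}`. -/
def T {N : ℕ} (π : Matrix (Fin N) (Fin N) ℝ) : {p : Fin N × Fin N // p.1 < p.2} → ℝ :=
  fun p => π p.1.1 p.1.2 + π p.1.2 p.1.1

/-- The Frobenius product with a fixed matrix, as a linear functional. -/
def frobLinear {N : ℕ} (c : Matrix (Fin N) (Fin N) ℝ) : Matrix (Fin N) (Fin N) ℝ →ₗ[ℝ] ℝ where
  toFun := frob c
  map_add' x y := by simp [frob, mul_add, Finset.sum_add_distrib]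
  map_smul' a x := by simp [frob, Finset.mul_sum, mul_left_comm]

lemma frobLinear_apply {N : ℕ} (c x : Matrix (Fin N) (Fin N) ℝ) : frobLinear c x = frob c x := rfl

lemma frob_sum_smul {N : ℕ} {ι : Type*} [Fintype ι] (c : Matrix (Fin N) (Fin N) ℝ) (a : ι → ℝ)
    (u : ι → Matrix (Fin N) (Fin N) ℝ) : frob c (∑ l, a l • u l) = ∑ l, a l * frob c (u l) := by
  simp only [← frobLinear_apply, map_sum, map_smul, smul_eq_mul]

lemma frob_add_smul_left {N : ℕ} (c d x : Matrix (Fin N) (Fin N) ℝ) (t : ℝ) :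
    frob (c + t • d) x = frob c x + t * frob d x := by
  simp [frob, add_mul, Finset.sum_add_distrib, Finset.mul_sum, mul_assoc]

lemma frob_sub_left {N : ℕ} (c d x : Matrix (Fin N) (Fin N) ℝ) :
    frob (c - d) x = frob c x - frob d x := by
  simp [frob, sub_mul, Finset.sum_sub_distrib]

lemma continuous_frob {N : ℕ} (c : Matrix (Fin N) (Fin N) ℝ) : Continuous (frob c) := by
  unfold frob
  fun_prop

lemma isCompact_Plans {N : ℕ} (μ ν : Fin N → ℝ) : IsCompact (Plans μ ν) := by
  have hbox : IsCompact (Set.pi Set.univ fun i : Fin N =>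
      Set.pi Set.univ fun _ : Fin N => Set.Icc (0 : ℝ) (μ i)) :=
    isCompact_univ_pi fun _ => isCompact_univ_pi fun _ => isCompact_Icc
  refine IsCompact.of_isClosed_subset hbox ?_ ?_
  · simp only [Plans, Set.ofPred_and, Set.ofPred_forall]
    refine (isClosed_iInter fun i => isClosed_iInter fun j => ?_).inter
      ((isClosed_iInter fun i => ?_).inter (isClosed_iInter fun j => ?_))
    · exact isClosed_le continuous_const (by fun_prop)
    · exact isClosed_eq (by fun_prop) continuous_const
    · exact isClosed_eq (by fun_prop) continuous_const
  · rintro x ⟨h0, hr, -⟩ i - j -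
    refine ⟨h0 i j, ?_⟩
    rw [← hr i]
    exact Finset.single_le_sum (f := fun j => x i j) (fun j _ => h0 i j) (Finset.mem_univ j)

lemma convex_Plans {N : ℕ} (μ ν : Fin N → ℝ) : Convex ℝ (Plans μ ν) := by
  rintro x ⟨hx, hxr, hxc⟩ y ⟨hy, hyr, hyc⟩ a b ha hb hab
  refine ⟨fun i j => ?_, fun i => ?_, fun j => ?_⟩
  · simpa using add_nonneg (mul_nonneg ha (hx i j)) (mul_nonneg hb (hy i j))
  · simp [Finset.sum_add_distrib, ← Finset.mul_sum, hxr, hyr, ← add_mul, hab]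
  · simp [Finset.sum_add_distrib, ← Finset.mul_sum, hxc, hyc, ← add_mul, hab]

lemma OTcost_le_frob {N : ℕ} (c : Matrix (Fin N) (Fin N) ℝ) {μ ν : Fin N → ℝ}
    {x : Matrix (Fin N) (Fin N) ℝ} (hx : x ∈ Plans μ ν) : OTcost c μ ν ≤ frob c x :=
  csInf_le ((isCompact_Plans μ ν).image (continuous_frob c)).bddBelow ⟨x, hx, rfl⟩

/-- If a convex combination with positive weights of plans is optimal, so is every plan in it. -/
lemma frob_eq_OTcost_of_sum_smul {N : ℕ} {ι : Type*} [Fintype ι] (c : Matrix (Fin N) (Fin N) ℝ)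
    {μ ν : Fin N → ℝ} {u : ι → Matrix (Fin N) (Fin N) ℝ} (hu : ∀ l, u l ∈ Plans μ ν)
    {a : ι → ℝ} (ha : ∀ l, 0 < a l) (ha1 : ∑ l, a l = 1)
    (hopt : frob c (∑ l, a l • u l) = OTcost c μ ν) (l : ι) :
    frob c (u l) = OTcost c μ ν := by
  have hzero : ∑ l, a l * (frob c (u l) - OTcost c μ ν) = 0 := by
    simp only [mul_sub, Finset.sum_sub_distrib, ← Finset.sum_mul, ha1, one_mul]
    rw [← frob_sum_smul, hopt, sub_self]
  have hnonneg : ∀ l ∈ Finset.univ, 0 ≤ a l * (frob c (u l) - OTcost c μ ν) := fun l _ =>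
    mul_nonneg (ha l).le (sub_nonneg.2 (OTcost_le_frob c (hu l)))
  have hl := (Finset.sum_eq_zero_iff_of_nonneg hnonneg).1 hzero l (Finset.mem_univ l)
  exact sub_eq_zero.1 ((mul_eq_zero.1 hl).resolve_left (ha l).ne')

open Topology in
/-- An extreme plan is the only plan supported in its support. -/
lemma eq_of_mem_EP_of_support {N : ℕ} {μ ν : Fin N → ℝ} {w x : Matrix (Fin N) (Fin N) ℝ}
    (hw : w ∈ EP μ ν) (hx : x ∈ Plans μ ν) (h : ∀ i j, w i j = 0 → x i j = 0) : x = w := by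
  obtain ⟨⟨hw0, hwr, hwc⟩, hext⟩ := hw
  obtain ⟨hx0, hxr, hxc⟩ := hx
  have hsmall : ∀ᶠ t : ℝ in 𝓝[>] 0, ∀ i j, 0 ≤ w i j - t * (x i j - w i j) := by
    refine Filter.eventually_all.2 fun i => Filter.eventually_all.2 fun j => ?_
    rcases (hw0 i j).eq_or_lt with hij | hij
    · filter_upwards with t
      simp [← hij, h i j hij.symm]
    · have hcont : Filter.Tendsto (fun t : ℝ => w i j - t * (x i j - w i j)) (𝓝[>] 0)
          (𝓝 (w i j)) := by
        refine Filter.Tendsto.mono_left ?_ nhdsWithin_le_nhds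
        exact Continuous.tendsto' (by fun_prop) _ _ (by simp)
      exact (hcont.eventually (lt_mem_nhds hij)).mono fun _ => le_of_lt
  obtain ⟨t, ht, htpos⟩ := (hsmall.and self_mem_nhdsWithin).exists
  have htpos : 0 < t := htpos
  have hy : w - t • (x - w) ∈ Plans μ ν := by
    refine ⟨fun i j => by simpa using ht i j, fun i => ?_, fun j => ?_⟩
    · simp [Finset.sum_sub_distrib, ← Finset.mul_sum, hwr, hxr]
    · simp [Finset.sum_sub_distrib, ← Finset.mul_sum, hwc, hxc]
  refine hext ⟨hx0, hxr, hxc⟩ hy ?_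
  refine ⟨t / (1 + t), 1 / (1 + t), by positivity, by positivity, by field_simp; ring, ?_⟩
  ext i j
  simp only [Matrix.add_apply, Matrix.smul_apply, Matrix.sub_apply, smul_eq_mul]
  field_simp
  ring

lemma finite_EP {N : ℕ} (μ ν : Fin N → ℝ) : (EP μ ν).Finite := by
  refine Set.Finite.of_finite_image
    (f := fun w : Matrix (Fin N) (Fin N) ℝ => {p : Fin N × Fin N | w p.1 p.2 = 0})
    (Set.toFinite _) fun x hx w hw hxw => ?_
  exact eq_of_mem_EP_of_support hw hx.1 fun i j hij => (Set.ext_iff.1 hxw (i, j)).2 hij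

/-- A lower bound for a linear cost on the extreme plans holds on all plans. -/
lemma le_frob_of_forall_mem_EP {N : ℕ} (c : Matrix (Fin N) (Fin N) ℝ) {μ ν : Fin N → ℝ} {a : ℝ}
    (h : ∀ w ∈ EP μ ν, a ≤ frob c w) {x : Matrix (Fin N) (Fin N) ℝ} (hx : x ∈ Plans μ ν) :
    a ≤ frob c x := by
  have hKM : closure (convexHull ℝ (EP μ ν)) = Plans μ ν :=
    closure_convexHull_extremePoints (E := Fin N → Fin N → ℝ) (isCompact_Plans μ ν)
      (convex_Plans μ ν)
  rw [← hKM] at hx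
  exact closure_minimal (convexHull_min h (convex_halfSpace_ge (frobLinear c).isLinear a))
    (isClosed_le continuous_const (continuous_frob c)) hx

lemma frob_eq_sum_T {N : ℕ} {d : Matrix (Fin N) (Fin N) ℝ} (hd : d ∈ Sym0 N)
    (x : Matrix (Fin N) (Fin N) ℝ) :
    frob d x = ∑ p : {p : Fin N × Fin N // p.1 < p.2}, T x p * d p.1.1 p.1.2 := by
  have hsub : ∑ p : {p : Fin N × Fin N // p.1 < p.2}, T x p * d p.1.1 p.1.2 =
      ∑ p : Fin N × Fin N, if p.1 < p.2 then (x p.1 p.2 + x p.2 p.1) * d p.1 p.2 else 0 := by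
    rw [← Finset.sum_filter]
    exact (Finset.sum_subtype _ (by simp) fun p : Fin N × Fin N =>
      (x p.1 p.2 + x p.2 p.1) * d p.1 p.2).symm
  have hsplit : ∀ i j, d i j * x i j =
      (if i < j then x i j * d i j else 0) + (if j < i then x i j * d j i else 0) := by
    intro i j
    rcases lt_trichotomy i j with h | rfl | h
    · simp [h, h.not_gt, mul_comm]
    · simp [hd.1]
    · simp [h, h.not_gt, mul_comm, hd.2 i j]
  rw [hsub, Fintype.sum_prod_type]
  simp only [frob, hsplit, Finset.sum_add_distrib]
  rw [Finset.sum_comm (f := fun i j => if j < i then x i j * d j i else 0)]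
  simp only [← Finset.sum_add_distrib]
  refine Finset.sum_congr rfl fun i _ => Finset.sum_congr rfl fun j _ => ?_
  split_ifs <;> ring

lemma card_lt_pairs (N : ℕ) :
    Fintype.card {p : Fin N × Fin N // p.1 < p.2} = N * (N - 1) / 2 := by
  rw [Fintype.card_subtype, Finset.card_filter, Fintype.sum_prod_type_right,
    ← Finset.sum_range_id, ← Fin.sum_univ_eq_sum_range (fun i => i)]
  refine Finset.sum_congr rfl fun j _ => ?_
  rw [← Finset.card_filter, ← Fin.card_Iio j]
  congr 1
  ext i
  simp

lemma eq_zero_of_mem_Sym0 {N : ℕ} {d : Matrix (Fin N) (Fin N) ℝ} (hd : d ∈ Sym0 N)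
    (h : ∀ i j, i < j → d i j = 0) : d = 0 := by
  ext i j
  rcases lt_trichotomy i j with hij | rfl | hij
  · exact h i j hij
  · exact hd.1 i
  · rw [hd.2]
    exact h j i hij

/-- A symmetric cost annihilating matrices whose symmetrizations span everything vanishes. -/
lemma eq_zero_of_frob_eq_zero {N : ℕ} {d : Matrix (Fin N) (Fin N) ℝ} (hd : d ∈ Sym0 N)
    {v : Fin (N * (N - 1) / 2) → ({p : Fin N × Fin N // p.1 < p.2} → ℝ)}
    (hv : LinearIndependent ℝ v) (h : ∀ r, ∃ x, v r = T x ∧ frob d x = 0) : d = 0 := by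
  have hspan : Submodule.span ℝ (Set.range v) = ⊤ :=
    hv.span_eq_top_of_card_eq_finrank' (by simp [card_lt_pairs])
  let f := Fintype.linearCombination ℝ
    (fun p : {p : Fin N × Fin N // p.1 < p.2} => d p.1.1 p.1.2)
  have hf : f = 0 := by
    refine LinearMap.ext_on_range hspan fun r => ?_
    obtain ⟨x, hx, hdx⟩ := h r
    simpa [f, Fintype.linearCombination_apply, hx, ← frob_eq_sum_T hd] using hdx
  refine eq_zero_of_mem_Sym0 hd fun i j hij => ?_
  simpa [f] using LinearMap.congr_fun hf (Pi.single ⟨(i, j), hij⟩ 1)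

/-- A proper subspace of symmetrizations is annihilated by a nonzero symmetric cost. -/
lemma exists_Sym0_ne_zero_of_finrank_lt {N : ℕ}
    {W : Submodule ℝ ({p : Fin N × Fin N // p.1 < p.2} → ℝ)}
    (hW : Module.finrank ℝ W < N * (N - 1) / 2) :
    ∃ d ∈ Sym0 N, d ≠ 0 ∧ ∀ x, T x ∈ W → frob d x = 0 := by
  have hlt : W < ⊤ := by
    refine lt_top_iff_ne_top.2 fun htop => hW.ne ?_
    rw [htop, finrank_top, Module.finrank_fintype_fun_eq_card, card_lt_pairs]
  obtain ⟨f, hf, hWf⟩ := W.exists_le_ker_of_lt_top hlt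
  let d : Matrix (Fin N) (Fin N) ℝ := fun i j =>
    if h : i < j then f (Pi.single ⟨(i, j), h⟩ 1)
    else if h : j < i then f (Pi.single ⟨(j, i), h⟩ 1) else 0
  have hd : d ∈ Sym0 N := by
    refine ⟨fun i => by simp [d], fun i j => ?_⟩
    rcases lt_trichotomy i j with h | rfl | h
    · simp [d, h, h.not_gt]
    · rfl
    · simp [d, h, h.not_gt]
  have hdp : ∀ p : {p : Fin N × Fin N // p.1 < p.2}, d p.1.1 p.1.2 = f (Pi.single p 1) :=
    fun p => dif_pos p.2
  refine ⟨d, hd, fun h0 => hf ?_, fun x hx => ?_⟩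
  · refine LinearMap.pi_ext' fun p => LinearMap.ext_ring ?_
    simpa [h0] using (hdp p).symm
  · rw [frob_eq_sum_T hd, ← LinearMap.mem_ker.1 (hWf hx), LinearMap.pi_apply_eq_sum_univ f (T x)]
    refine Finset.sum_congr rfl fun p _ => ?_
    rw [hdp, smul_eq_mul]
    congr 2
    ext q
    simp [Pi.single_apply, eq_comm]

open Topology in
/-- A perturbation of the cost in a direction vanishing on the optimal plans keeps the optimal
value a lower bound, as long as it is small enough. -/
lemma eventually_forall_OTcost_le_frob {N : ℕ} (c d : Matrix (Fin N) (Fin N) ℝ) (μ ν : Fin N → ℝ)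
    (hd : ∀ x ∈ OPT c μ ν, frob d x = 0) :
    ∀ᶠ t : ℝ in 𝓝[>] 0, ∀ x ∈ Plans μ ν, OTcost c μ ν ≤ frob (c + t • d) x := by
  have hEP : ∀ᶠ t : ℝ in 𝓝[>] 0, ∀ w ∈ EP μ ν, OTcost c μ ν ≤ frob (c + t • d) w := by
    refine (Filter.eventually_all_finite (finite_EP μ ν)).2 fun w hw => ?_
    simp only [frob_add_smul_left]
    rcases (OTcost_le_frob c hw.1).eq_or_lt with h | h
    · filter_upwards with t
      rw [hd w ⟨hw.1, h.symm⟩, mul_zero, add_zero, h]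
    · have hcont : Filter.Tendsto (fun t : ℝ => frob c w + t * frob d w) (𝓝[>] 0)
          (𝓝 (frob c w)) := by
        refine Filter.Tendsto.mono_left ?_ nhdsWithin_le_nhds
        exact Continuous.tendsto' (by fun_prop) _ _ (by simp)
      exact (hcont.eventually (lt_mem_nhds h)).mono fun _ => le_of_lt
  exact hEP.mono fun t ht x hx => le_frob_of_forall_mem_EP _ ht hx

/-- Identifiability of a symmetric cost matrix with zero diagonal from total costs and OT
plans: direct part (a) and converse part (b). -/
theorem stmt15 (N K : ℕ) (hN : 1 ≤ N)
    (μ ν : Fin K → Fin N → ℝ)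
    (hμ : ∀ k, μ k ∈ stdSimplex ℝ (Fin N)) (hν : ∀ k, ν k ∈ stdSimplex ℝ (Fin N))
    (hdist : Function.Injective (fun k => (μ k, ν k)))
    (c : Matrix (Fin N) (Fin N) ℝ) (hc : c ∈ Sym0 N)
    (π : Fin K → Matrix (Fin N) (Fin N) ℝ) (hπ : ∀ k, π k ∈ OPT c (μ k) (ν k))
    (α : Fin K → ℝ) (hα : ∀ k, α k = frob c (π k))
    (L : Fin K → ℕ) (u : (k : Fin K) → Fin (L k) → Matrix (Fin N) (Fin N) ℝ)
    (hu : ∀ k ℓ, u k ℓ ∈ EP (μ k) (ν k))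
    (hrep : ∀ k, ∃ lam : Fin (L k) → ℝ,
      (∀ ℓ, 0 < lam ℓ) ∧ (∑ ℓ, lam ℓ = 1) ∧ π k = ∑ ℓ, lam ℓ • u k ℓ) :
    -- (a) sufficient condition for identifiability in `Sym⁰_N`
    ((∃ v : Fin (N * (N - 1) / 2) → ({p : Fin N × Fin N // p.1 < p.2} → ℝ),
        (∀ r, ∃ k ℓ, v r = T (u k ℓ)) ∧ LinearIndependent ℝ v) →
      ∀ c' ∈ Sym0 N,
        (∀ k, frob c' (π k) = α k ∧ OTcost c' (μ k) (ν k) = α k) → c' = c) ∧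
    -- (b) converse
    ((∀ k, convexHull ℝ (Set.range (u k)) = OPT c (μ k) (ν k)) →
      Module.finrank ℝ (Submodule.span ℝ
          {x : {p : Fin N × Fin N // p.1 < p.2} → ℝ | ∃ k ℓ, x = T (u k ℓ)}) <
        N * (N - 1) / 2 →
      ∃ c' ∈ Sym0 N, c' ≠ c ∧
        ∀ k, frob c' (π k) = α k ∧ OTcost c' (μ k) (ν k) = α k) := by
  choose lam hlam hlam1 hcomb using hrep
  refine ⟨?_, fun hhull hrank => ?_⟩
  · rintro ⟨v, hvu, hv⟩ c' hc' hcost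
    have hd : c' - c ∈ Sym0 N :=
      ⟨fun i => by simp [hc.1, hc'.1], fun i j => by simp [hc.2 i j, hc'.2 i j]⟩
    refine sub_eq_zero.1 (eq_zero_of_frob_eq_zero hd hv fun r => ?_)
    obtain ⟨k, ℓ, hr⟩ := hvu r
    have hplans : ∀ ℓ, u k ℓ ∈ Plans (μ k) (ν k) := fun ℓ => (hu k ℓ).1
    have h' := frob_eq_OTcost_of_sum_smul c' hplans (hlam k) (hlam1 k)
      (by rw [← hcomb, (hcost k).1, (hcost k).2]) ℓ
    have h := frob_eq_OTcost_of_sum_smul c hplans (hlam k) (hlam1 k)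
      (by rw [← hcomb, (hπ k).2]) ℓ
    refine ⟨u k ℓ, hr, ?_⟩
    rw [frob_sub_left, h', h, (hcost k).2, hα, (hπ k).2, sub_self]
  · obtain ⟨d, hd, hd0, hdW⟩ := exists_Sym0_ne_zero_of_finrank_lt hrank
    have hdu : ∀ k ℓ, frob d (u k ℓ) = 0 := fun k ℓ =>
      hdW _ (Submodule.subset_span ⟨k, ℓ, rfl⟩)
    have hdopt : ∀ k, ∀ x ∈ OPT c (μ k) (ν k), frob d x = 0 := by
      intro k x hx
      rw [← hhull k] at hx
      exact convexHull_min (Set.range_subset_iff.2 (hdu k))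
        (convex_hyperplane (frobLinear d).isLinear 0) hx
    obtain ⟨t, ht, htpos⟩ := ((Filter.eventually_all.2 fun k =>
      eventually_forall_OTcost_le_frob c d (μ k) (ν k) (hdopt k)).and
        (self_mem_nhdsWithin (a := (0 : ℝ)))).exists
    have hval : ∀ k, frob (c + t • d) (π k) = α k := fun k => by
      rw [frob_add_smul_left, hdopt k _ (hπ k), mul_zero, add_zero, hα]
    refine ⟨c + t • d, ⟨fun i => by simp [hc.1, hd.1], fun i j => by simp [hc.2 i j, hd.2 i j]⟩,
      ?_, fun k => ⟨hval k, IsLeast.csInf_eq ⟨⟨π k, (hπ k).1, hval k⟩, ?_⟩⟩⟩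
    · simpa [hd0] using (Set.mem_Ioi.1 htpos).ne'
    · rintro _ ⟨x, hx, rfl⟩
      rw [hα, (hπ k).2]
      exact ht k x hx
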